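/- The input-state-output representation (A,B,C,D) of the convolutional code C(A,B,C,D) is minimal (i.e., the state dimension s equals the degree δ of the code) if and only if the pair (A,B) is reachable. -/

import Mathlib

open Polynomial Matrix

section Degree

variable {R ι : Type*} [CommRing R] [Fintype ι] [DecidableEq ι]

theorem Matrix.natDegree_det_le_of_forall_natDegree_le (M : Matrix ι ι R[X]) (d : ℕ)
    (h : ∀ i j, (M i j).natDegree ≤ d) : M.det.natDegree ≤ Fintype.card ι * d := by
  rw [det_apply]
  refine natDegree_sum_le_of_forall_le _ _ fun g _ => (natDegree_smul_le _ _).trans ?_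
  refine (natDegree_prod_le _ _).trans ?_
  simpa using Finset.sum_le_card_nsmul Finset.univ _ d fun i _ => h (g i) i

theorem Matrix.natDegree_mul_apply_le {l m n : Type*} [Fintype m] {M : Matrix l m R[X]}
    {N : Matrix m n R[X]} {a b : ℕ} (hM : ∀ i j, (M i j).natDegree ≤ a)
    (hN : ∀ i j, (N i j).natDegree ≤ b) (i : l) (j : n) : ((M * N) i j).natDegree ≤ a + b := by
  rw [mul_apply]
  exact natDegree_sum_le_of_forall_le _ _ fun t _ =>
    natDegree_mul_le.trans (add_le_add (hM i t) (hN t j))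

theorem Matrix.natDegree_charmatrix_apply_le (A : Matrix ι ι R) (i j : ι) :
    (A.charmatrix i j).natDegree ≤ 1 := by
  by_cases h : i = j
  · subst h
    simpa using natDegree_X_sub_C_le (A i i)
  · simp [charmatrix_apply_ne _ _ _ h]

theorem Matrix.natDegree_adjugate_charmatrix_apply_le (A : Matrix ι ι R) (i j : ι) :
    (A.charmatrix.adjugate i j).natDegree ≤ Fintype.card ι := by
  rw [adjugate_apply]
  refine (natDegree_det_le_of_forall_natDegree_le _ 1 fun a b => ?_).trans (mul_one _).le
  by_cases h : a = j
  · subst h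
    by_cases h' : b = i
    · subst h'; simp
    · simp [h']
  · simpa [updateRow_ne h] using natDegree_charmatrix_apply_le A a b

end Degree

section FinrankQuotient

variable {F ι : Type*} [Field F] [Fintype ι] [DecidableEq ι]

theorem Matrix.finrank_quotient_range_mulVecLin (M : Matrix ι ι F[X]) (hM : M.det ≠ 0) :
    Module.finrank F ((ι → F[X]) ⧸ LinearMap.range M.mulVecLin) = M.det.natDegree := by
  have hinj : Function.Injective M.mulVecLin := mulVec_injective_of_det_ne_zero hM
  let e := LinearEquiv.ofInjective M.mulVecLin hinj
  let b := Pi.basisFun F[X] ι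
  have h : Module.finrank F[X] (LinearMap.range M.mulVecLin) = Module.finrank F[X] (ι → F[X]) :=
    e.finrank_eq.symm
  let a := Submodule.smithNormalFormCoeffs b h
  let bM := Submodule.smithNormalFormTopBasis b h
  let bN := Submodule.smithNormalFormBotBasis b h
  have hab : ∀ i, (bN i : ι → F[X]) = a i • bM i := Submodule.smithNormalFormBotBasis_def b h
  have ha : ∀ i, a i ≠ 0 := fun i h0 => by
    apply bN.ne_zero i
    ext1
    simp [hab, h0]
  have hassoc : Associated (∏ i, a i) M.det := by
    rw [← det_diagonal, ← LinearMap.det_toLin bM, ← LinearMap.det_toLin' M]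
    refine LinearMap.associated_det_of_eq_comp (bM.equiv (bN.map e.symm) (Equiv.refl _)) _ _ ?_
    intro x
    have key : toLin bM bM (diagonal a) =
        toLin' M ∘ₗ (bM.equiv (bN.map e.symm) (Equiv.refl _)).toLinearMap := by
      refine bM.ext fun i => ?_
      have h1 : toLin' M (e.symm (bN i)) = (bN i : ι → F[X]) :=
        congrArg Subtype.val (e.apply_symm_apply (bN i))
      simp [toLin_self, diagonal_apply, h1, hab]
    exact LinearMap.congr_fun key x
  have : ∀ i, FiniteDimensional F (F[X] ⧸ Ideal.span ({a i} : Set F[X])) := fun i =>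
    PowerBasis.finite <| AdjoinRoot.powerBasis <| ha i
  rw [← natDegree_eq_of_degree_eq (degree_eq_degree_of_associated hassoc),
    natDegree_prod _ _ fun i _ => ha i, Submodule.finrank_quotient_eq_sum F b h]
  congr with i
  exact (AdjoinRoot.powerBasis <| ha i).finrank

end FinrankQuotient

section Reachability

variable {F σ κ : Type*} [Field F] [Fintype σ] [DecidableEq σ] [Fintype κ]

/-- The `F`-linear map sending a polynomial vector `∑ zⁱ wᵢ` to `∑ Aⁱ wᵢ`. -/
noncomputable def Matrix.evalVec (A : Matrix σ σ F) : (σ → F[X]) →ₗ[F] (σ → F) where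
  toFun w := fun j => ∑ l, aeval A (w l) j l
  map_add' w w' := by
    ext j
    simp [Finset.sum_add_distrib]
  map_smul' c w := by
    ext j
    simp [Finset.mul_sum]

theorem Matrix.evalVec_apply (A : Matrix σ σ F) (w : σ → F[X]) (j : σ) :
    A.evalVec w j = ∑ l, aeval A (w l) j l := rfl

theorem Matrix.evalVec_smul (A : Matrix σ σ F) (p : F[X]) (w : σ → F[X]) :
    A.evalVec (p • w) = aeval A p *ᵥ A.evalVec w := by
  ext j
  simp only [evalVec_apply, mulVec, dotProduct, Pi.smul_apply, smul_eq_mul, map_mul, mul_apply,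
    Finset.mul_sum]
  exact Finset.sum_comm

theorem Matrix.evalVec_C (A : Matrix σ σ F) (v : σ → F) : A.evalVec (fun i => C (v i)) = v := by
  ext j
  simp [evalVec_apply, Algebra.algebraMap_eq_smul_one, one_apply]

theorem Matrix.evalVec_mulVec_map_C (A : Matrix σ σ F) (B : Matrix σ κ F) (u : κ → F[X]) :
    A.evalVec (B.map C *ᵥ u) = ∑ c, aeval A (u c) *ᵥ B.col c := by
  have : B.map C *ᵥ u = ∑ c, u c • fun i => C (B.col c i) := by
    ext1 i
    simp [mulVec, dotProduct, mul_comm]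
  simp_rw [this, map_sum, evalVec_smul, evalVec_C]

theorem Matrix.charmatrix_mulVec (A : Matrix σ σ F) (x : σ → F[X]) :
    A.charmatrix *ᵥ x = (X : F[X]) • x - A.map C *ᵥ x := by
  ext1 i
  simp [charmatrix, sub_mulVec]

theorem Matrix.evalVec_charmatrix_mulVec (A : Matrix σ σ F) (x : σ → F[X]) :
    A.evalVec (A.charmatrix *ᵥ x) = 0 := by
  rw [charmatrix_mulVec, map_sub, evalVec_smul, evalVec_mulVec_map_C, aeval_X, sub_eq_zero]
  ext j
  simp only [mulVec, dotProduct, evalVec_apply, Finset.sum_apply, col_apply, Finset.mul_sum]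
  rw [Finset.sum_comm]
  refine Finset.sum_congr rfl fun l _ => ?_
  have h : A * aeval A (x l) = aeval A (x l) * A := by
    simpa using congrArg (aeval A) (mul_comm X (x l))
  simpa only [mul_apply] using congrFun (congrFun h j) l

theorem Matrix.smul_sub_mem_range_charmatrix (A : Matrix σ σ F) (p : F[X]) (v : σ → F) :
    (p • fun i => C (v i)) - (fun i => C ((aeval A p *ᵥ v) i)) ∈
      LinearMap.range A.charmatrix.mulVecLin := by
  induction p using Polynomial.induction_on generalizing v with
  | C a =>
    have h0 : (C a • fun i => C (v i)) - (fun i => C ((aeval A (C a) *ᵥ v) i)) = 0 := by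
      ext1 i
      simp [Algebra.algebraMap_eq_smul_one, smul_mulVec]
    rw [h0]
    exact zero_mem _
  | add p q hp hq =>
    convert add_mem (hp v) (hq v) using 1
    ext1 i
    simp [add_mulVec, add_mul]
    ring
  | monomial n a h =>
    set w := aeval A (C a * X ^ n) *ᵥ v with hw
    have hA : aeval A (C a * X ^ (n + 1)) *ᵥ v = A *ᵥ w := by
      rw [hw, mulVec_mulVec, pow_succ', mul_left_comm, map_mul, aeval_X]
    have hmem : A.charmatrix *ᵥ (fun i => C (w i)) ∈ LinearMap.range A.charmatrix.mulVecLin :=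
      ⟨_, rfl⟩
    convert add_mem (Submodule.smul_mem _ X (h v)) hmem using 1
    rw [hA, charmatrix_mulVec, ← hw]
    ext1 i
    simp only [mulVec, dotProduct, Pi.sub_apply, Pi.add_apply, Pi.smul_apply, smul_eq_mul,
      map_apply, map_sum, map_mul]
    ring

theorem Matrix.evalVec_eq_zero_iff (A : Matrix σ σ F) (w : σ → F[X]) :
    A.evalVec w = 0 ↔ ∃ x, A.charmatrix *ᵥ x = w := by
  constructor
  · intro h
    have hw : w = ∑ l, ((w l • fun i => C ((Pi.single l 1 : σ → F) i)) -
        (fun i => C ((aeval A (w l) *ᵥ Pi.single l 1) i))) := by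
      ext1 i
      have := congrArg C (congrFun h i)
      simp only [evalVec_apply, map_sum] at this
      simp [Pi.single_apply, this, apply_ite C]
    have := sum_mem (t := Finset.univ) fun l (_ : l ∈ Finset.univ) =>
      smul_sub_mem_range_charmatrix A (w l) (Pi.single l 1)
    rw [← hw] at this
    simpa using this
  · rintro ⟨x, rfl⟩
    exact evalVec_charmatrix_mulVec A x

theorem Matrix.exists_aeval_eq_sum_pow (A : Matrix σ σ F) (s : ℕ) (hs : Fintype.card σ = s)
    (p : F[X]) : ∃ y : Fin s → F, aeval A p = ∑ i, y i • A ^ (i : ℕ) := by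
  rcases isEmpty_or_nonempty σ with h | h
  · exact ⟨0, Subsingleton.elim _ _⟩
  refine ⟨fun i => (p %ₘ A.charpoly).coeff i, ?_⟩
  rw [aeval_eq_aeval_mod_charpoly, aeval_eq_sum_range' (n := s)]
  · exact Finset.sum_range _
  · rw [← hs, ← charpoly_natDegree_eq_dim A]
    refine natDegree_modByMonic_lt _ A.charpoly_monic fun h1 => ?_
    have h2 := charpoly_natDegree_eq_dim A
    rw [h1, natDegree_one] at h2
    exact Fintype.card_ne_zero h2.symm

/-- The polynomial inputs that drive the zero state back to zero, as an `F[X]`-module. -/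
noncomputable def Matrix.inputModule (A : Matrix σ σ F) (B : Matrix σ κ F) :
    Submodule F[X] (κ → F[X]) :=
  (LinearMap.range A.charmatrix.mulVecLin).comap (B.map C).mulVecLin

theorem Matrix.mem_inputModule (A : Matrix σ σ F) (B : Matrix σ κ F) (u : κ → F[X]) :
    u ∈ A.inputModule B ↔ ∃ x, A.charmatrix *ᵥ x = B.map C *ᵥ u := Iff.rfl

theorem Matrix.finrank_quotient_inputModule (A : Matrix σ σ F) (B : Matrix σ κ F)
    (s : ℕ) (hs : Fintype.card σ = s) :
    Module.finrank F ((κ → F[X]) ⧸ A.inputModule B) =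
      Matrix.rank (fun (i : σ) (p : Fin s × κ) => (A ^ (p.1 : ℕ) * B) i p.2) := by
  let φ : (κ → F[X]) →ₗ[F] (σ → F) := A.evalVec ∘ₗ (B.map C).mulVecLin.restrictScalars F
  have hφ : ∀ u, φ u = ∑ c, aeval A (u c) *ᵥ B.col c := evalVec_mulVec_map_C A B
  have hker : (A.inputModule B).restrictScalars F = LinearMap.ker φ := by
    ext u
    exact (evalVec_eq_zero_iff A _).symm
  rw [← (Submodule.Quotient.restrictScalarsEquiv F (A.inputModule B)).finrank_eq, hker,
    φ.quotKerEquivRange.finrank_eq]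
  have hcol : ∀ (i : Fin s) (c : κ), (A ^ (i : ℕ)) *ᵥ B.col c = fun j => (A ^ (i : ℕ) * B) j c :=
    fun i c => rfl
  have hR : ∀ y, mulVecLin (fun (i : σ) (p : Fin s × κ) => (A ^ (p.1 : ℕ) * B) i p.2) y =
      ∑ c, ∑ i, y (i, c) • (A ^ (i : ℕ)) *ᵥ B.col c := by
    intro y
    ext j
    change ∑ p : Fin s × κ, (A ^ (p.1 : ℕ) * B) j p.2 * y p = _
    simp [Fintype.sum_prod_type_right, hcol, mul_comm]
  suffices h : LinearMap.range φ =
      LinearMap.range (mulVecLin fun (i : σ) (p : Fin s × κ) => (A ^ (p.1 : ℕ) * B) i p.2) from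
    congrArg (fun V : Submodule F (σ → F) => Module.finrank F V) h
  apply le_antisymm
  · rintro _ ⟨u, rfl⟩
    choose y hy using fun c => exists_aeval_eq_sum_pow A s hs (u c)
    refine ⟨fun p => y p.2 p.1, ?_⟩
    rw [hR, hφ]
    simp [hy, sum_mulVec, smul_mulVec]
  · rintro _ ⟨y, rfl⟩
    refine ⟨fun c => ∑ i : Fin s, C (y (i, c)) * X ^ (i : ℕ), ?_⟩
    rw [hR, hφ]
    refine Finset.sum_congr rfl fun c _ => ?_
    rw [map_sum, sum_mulVec]
    refine Finset.sum_congr rfl fun i _ => ?_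
    rw [map_mul, aeval_C, map_pow, aeval_X, ← Algebra.smul_def, smul_mulVec]

theorem Matrix.charpoly_smul_mem_inputModule (A : Matrix σ σ F) (B : Matrix σ κ F)
    (u : κ → F[X]) : A.charpoly • u ∈ A.inputModule B := by
  refine (mem_inputModule A B _).2 ⟨A.charmatrix.adjugate *ᵥ B.map C *ᵥ u, ?_⟩
  rw [mulVec_mulVec, mul_adjugate, smul_mulVec, one_mulVec, mulVec_smul, charpoly]

theorem Matrix.det_ne_zero_of_range_eq_inputModule [DecidableEq κ] (A : Matrix σ σ F)
    (B : Matrix σ κ F) (U : Matrix κ κ F[X])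
    (hU : LinearMap.range U.mulVecLin = A.inputModule B) : U.det ≠ 0 := by
  have h : ∀ c, ∃ m, U *ᵥ m = A.charpoly • Pi.single c 1 := fun c => by
    simpa [← hU] using charpoly_smul_mem_inputModule A B (Pi.single c 1)
  choose N hN using h
  have hUN : U * (of N)ᵀ = A.charpoly • (1 : Matrix κ κ F[X]) := by
    ext1 i j
    exact (congrFun (hN j) i).trans (by simp [Pi.single_apply, one_apply])
  intro h0
  have := congrArg det hUN
  rw [det_mul, h0, zero_mul, det_smul, det_one, mul_one] at this
  exact pow_ne_zero _ A.charpoly_monic.ne_zero this.symm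

theorem Matrix.natDegree_det_of_range_eq_inputModule [DecidableEq κ] (A : Matrix σ σ F)
    (B : Matrix σ κ F) (U : Matrix κ κ F[X])
    (hU : LinearMap.range U.mulVecLin = A.inputModule B) (s : ℕ) (hs : Fintype.card σ = s) :
    U.det.natDegree =
      Matrix.rank (fun (i : σ) (p : Fin s × κ) => (A ^ (p.1 : ℕ) * B) i p.2) := by
  rw [← finrank_quotient_inputModule A B s hs, ← hU,
    finrank_quotient_range_mulVecLin U (det_ne_zero_of_range_eq_inputModule A B U hU)]

theorem Matrix.exists_range_eq_inputModule (A : Matrix σ σ F) (B : Matrix σ κ F) :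
    ∃ U : Matrix κ κ F[X], LinearMap.range U.mulVecLin = A.inputModule B := by
  have hrank : Module.finrank F[X] (A.inputModule B) = Fintype.card κ := by
    apply le_antisymm
    · simpa using Submodule.finrank_le (A.inputModule B)
    · have hinj : Function.Injective ((LinearMap.lsmul F[X] (κ → F[X]) A.charpoly).codRestrict
          (A.inputModule B) (charpoly_smul_mem_inputModule A B)) :=
        (LinearMap.lsmul_injective A.charpoly_monic.ne_zero).codRestrict _
      simpa using LinearMap.finrank_le_finrank_of_injective hinj
  let b := (Module.finBasisOfFinrankEq F[X] (A.inputModule B) hrank).reindex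
    (Fintype.equivFin κ).symm
  refine ⟨of fun i j => (b j : κ → F[X]) i, ?_⟩
  rw [range_mulVecLin]
  have hcol : (of fun i j => (b j : κ → F[X]) i).col = (A.inputModule B).subtype ∘ b := rfl
  rw [hcol, Set.range_comp, ← Submodule.map_span, b.span_eq, Submodule.map_top,
    Submodule.range_subtype]

end Reachability

section Code

variable {F σ κ ρ : Type*} [Field F] [Fintype σ] [DecidableEq σ] [Fintype κ]

theorem Matrix.natDegree_det_submatrix_le [DecidableEq κ] (A : Matrix σ σ F)
    (B : Matrix σ κ F) (Cm : Matrix ρ σ F) (Dm : Matrix ρ κ F) (G : Matrix (ρ ⊕ κ) κ F[X])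
    (Y : Matrix σ κ F[X]) (hY : A.charmatrix * Y = B.map C * G.submatrix Sum.inr id)
    (hG : G.submatrix Sum.inl id = Cm.map C * Y + Dm.map C * G.submatrix Sum.inr id)
    (f : κ → ρ ⊕ κ) :
    (G.submatrix f id).det.natDegree ≤ (G.submatrix Sum.inr id).det.natDegree := by
  set U := G.submatrix Sum.inr id
  set d := Fintype.card σ
  have hd : A.charpoly.natDegree = d := charpoly_natDegree_eq_dim A
  have hdY : A.charpoly • Y = A.charmatrix.adjugate * B.map C * U := by
    rw [Matrix.mul_assoc, ← hY, ← Matrix.mul_assoc, adjugate_mul, smul_mul, Matrix.one_mul,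
      charpoly]
  let T : Matrix ρ κ F[X] :=
    Cm.map C * (A.charmatrix.adjugate * B.map C) + A.charpoly • Dm.map C
  let P : Matrix (ρ ⊕ κ) κ F[X] := fromRows T (A.charpoly • 1)
  have hP : A.charpoly • G = P * U := by
    rw [fromRows_mul]
    have h1 : T * U = A.charpoly • G.submatrix Sum.inl id := by
      rw [hG, smul_add, ← Matrix.mul_smul, hdY]
      simp [T, Matrix.add_mul, Matrix.mul_assoc]
    rw [h1]
    ext1 (i | i) j <;> simp [U]
  have hT : ∀ i j, (T i j).natDegree ≤ d := by
    intro i j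
    refine natDegree_add_le_of_degree_le ?_ ?_
    · refine (natDegree_mul_apply_le (a := 0) (b := d + 0) (by simp)
        (natDegree_mul_apply_le (natDegree_adjugate_charmatrix_apply_le A) (by simp)) i j).trans ?_
      simp
    · change (A.charpoly * C (Dm i j)).natDegree ≤ d
      exact (natDegree_mul_C_le _ _).trans hd.le
  have hPdeg : ∀ i j, (P i j).natDegree ≤ d := by
    rintro (i | i) j
    · exact hT i j
    · by_cases h : i = j
      · simp [P, h, hd]
      · simp [P, h]
  have hdet : A.charpoly ^ Fintype.card κ * (G.submatrix f id).det =
      (P.submatrix f id).det * U.det := by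
    rw [← det_smul, ← det_mul]
    congr 1
    ext1 i j
    exact congrFun (congrFun hP (f i)) j
  by_cases h0 : (G.submatrix f id).det = 0
  · simp [h0]
  have h1 := congrArg natDegree hdet
  rw [natDegree_mul (pow_ne_zero _ A.charpoly_monic.ne_zero) h0, natDegree_pow, hd] at h1
  have h2 := natDegree_det_le_of_forall_natDegree_le (P.submatrix f id) d fun i j => hPdeg _ _
  have h3 := natDegree_mul_le (p := (P.submatrix f id).det) (q := U.det)
  lia

/-- The polynomial code words `(y, u)` of the system `(A, B, C, D)`. -/
def isoCode (A : Matrix σ σ F) (B : Matrix σ κ F) (Cm : Matrix ρ σ F) (Dm : Matrix ρ κ F) :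
    Set ((ρ ⊕ κ) → F[X]) :=
  {v | ∃ x : σ → F[X],
    (X : F[X]) • x = (A.map Polynomial.C).mulVec x + (B.map Polynomial.C).mulVec (v ∘ Sum.inr) ∧
    v ∘ Sum.inl = (Cm.map Polynomial.C).mulVec x + (Dm.map Polynomial.C).mulVec (v ∘ Sum.inr)}

theorem mem_isoCode {A : Matrix σ σ F} {B : Matrix σ κ F} {Cm : Matrix ρ σ F}
    {Dm : Matrix ρ κ F} {v : (ρ ⊕ κ) → F[X]} :
    v ∈ isoCode A B Cm Dm ↔ ∃ x : σ → F[X], A.charmatrix *ᵥ x = B.map C *ᵥ (v ∘ Sum.inr) ∧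
      v ∘ Sum.inl = Cm.map C *ᵥ x + Dm.map C *ᵥ (v ∘ Sum.inr) := by
  simp only [charmatrix_mulVec, sub_eq_iff_eq_add']
  rfl

theorem range_inputRows_eq_inputModule {A : Matrix σ σ F} {B : Matrix σ κ F} {Cm : Matrix ρ σ F}
    {Dm : Matrix ρ κ F} {G : Matrix (ρ ⊕ κ) κ F[X]}
    (hG : isoCode A B Cm Dm = {v | ∃ m, v = G *ᵥ m}) :
    LinearMap.range (G.submatrix Sum.inr id).mulVecLin = A.inputModule B := by
  ext u
  constructor
  · rintro ⟨m, rfl⟩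
    have hm : G *ᵥ m ∈ isoCode A B Cm Dm := hG ▸ ⟨m, rfl⟩
    obtain ⟨x, hx, -⟩ := mem_isoCode.1 hm
    exact ⟨x, hx⟩
  · rintro ⟨x, hx⟩
    have hv : Sum.elim (Cm.map C *ᵥ x + Dm.map C *ᵥ u) u ∈ isoCode A B Cm Dm :=
      mem_isoCode.2 ⟨x, by simpa using hx, by simp⟩
    rw [hG] at hv
    obtain ⟨m, hm⟩ := hv
    exact ⟨m, (congrArg (· ∘ Sum.inr) hm).symm⟩

theorem natDegree_det_submatrix_le_of_isoCode_eq [DecidableEq κ] {A : Matrix σ σ F}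
    {B : Matrix σ κ F} {Cm : Matrix ρ σ F} {Dm : Matrix ρ κ F} {G : Matrix (ρ ⊕ κ) κ F[X]}
    (hG : isoCode A B Cm Dm = {v | ∃ m, v = G *ᵥ m}) (f : κ → ρ ⊕ κ) :
    (G.submatrix f id).det.natDegree ≤ (G.submatrix Sum.inr id).det.natDegree := by
  have h : ∀ c, G *ᵥ Pi.single c 1 ∈ isoCode A B Cm Dm := fun c => hG ▸ ⟨_, rfl⟩
  choose Y hY hY' using fun c => mem_isoCode.1 (h c)
  refine natDegree_det_submatrix_le A B Cm Dm G (of Y)ᵀ ?_ ?_ f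
  · ext1 i c
    refine (congrFun (hY c) i).trans ?_
    simp [mulVec, dotProduct, mul_apply]
  · ext1 i c
    refine Eq.trans ?_ ((congrFun (hY' c) i).trans ?_)
    · simp
    · simp [mulVec, dotProduct, mul_apply]

theorem exists_generator_isoCode [DecidableEq κ] (A : Matrix σ σ F) (B : Matrix σ κ F)
    (Cm : Matrix ρ σ F) (Dm : Matrix ρ κ F) :
    ∃ G : Matrix (ρ ⊕ κ) κ F[X], LinearIndependent F[X] G.transpose ∧
      isoCode A B Cm Dm = {v | ∃ m, v = G *ᵥ m} := by
  obtain ⟨U, hU⟩ := A.exists_range_eq_inputModule B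
  have hdet := det_ne_zero_of_range_eq_inputModule A B U hU
  have h : ∀ c, U *ᵥ Pi.single c 1 ∈ A.inputModule B := fun c => hU ▸ ⟨_, rfl⟩
  choose Y hY using fun c => (mem_inputModule A B _).1 (h c)
  have hAY : A.charmatrix * (of Y)ᵀ = B.map C * U := by
    ext1 i c
    refine (congrFun (hY c) i).trans ?_
    rw [mulVec_mulVec, mulVec_single_one]
    rfl
  have hinj : Function.Injective A.charmatrix.mulVec :=
    mulVec_injective_of_det_ne_zero A.charpoly_monic.ne_zero
  refine ⟨fromRows (Cm.map C * (of Y)ᵀ + Dm.map C * U) U, ?_, ?_⟩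
  · have hlin : LinearIndependent F[X] Uᵀ := by
      refine linearIndependent_rows_of_det_ne_zero (A := Uᵀ) ?_
      rwa [det_transpose]
    exact LinearIndependent.of_comp (LinearMap.funLeft F[X] F[X] Sum.inr) hlin
  · ext v
    rw [mem_isoCode, Set.mem_ofPred_eq]
    constructor
    · rintro ⟨x, hx, hv⟩
      have hu : v ∘ Sum.inr ∈ A.inputModule B := ⟨x, hx⟩
      rw [← hU] at hu
      obtain ⟨m, hm⟩ := hu
      have hm : U *ᵥ m = v ∘ Sum.inr := hm
      have hxm : x = (of Y)ᵀ *ᵥ m := hinj <| by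
        rw [hx, mulVec_mulVec, hAY, ← mulVec_mulVec, hm]
      refine ⟨m, ?_⟩
      rw [fromRows_mulVec, add_mulVec, ← mulVec_mulVec, ← mulVec_mulVec, hm, ← hxm, ← hv]
      exact (Sum.elim_comp_inl_inr v).symm
    · rintro ⟨m, rfl⟩
      refine ⟨(of Y)ᵀ *ᵥ m, ?_, ?_⟩
      · rw [mulVec_mulVec, hAY, fromRows_mulVec, Sum.elim_comp_inr, mulVec_mulVec]
      · rw [fromRows_mulVec, Sum.elim_comp_inr, Sum.elim_comp_inl, add_mulVec, mulVec_mulVec,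
          mulVec_mulVec]

end Code

/-- The ISO representation `(A,B,C,D)` of `𝒞(A,B,C,D)` is minimal (the state
dimension `s` equals the degree `δ` of the code, i.e. the maximal degree of the
`k×k` minors of a full column rank generator matrix) iff `(A,B)` is reachable. -/
theorem stmt14 (F : Type*) [Field F] [Fintype F] (s n k : ℕ)
    (A : Matrix (Fin s) (Fin s) F) (B : Matrix (Fin s) (Fin k) F)
    (Cm : Matrix (Fin (n - k)) (Fin s) F) (Dm : Matrix (Fin (n - k)) (Fin k) F) :
    (∃ G : Matrix (Fin (n - k) ⊕ Fin k) (Fin k) F[X],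
      LinearIndependent F[X] G.transpose ∧
      -- G generates the code 𝒞(A,B,C,D):
      {v : (Fin (n - k) ⊕ Fin k) → F[X] | ∃ x : Fin s → F[X],
          (X : F[X]) • x = (A.map Polynomial.C).mulVec x +
            (B.map Polynomial.C).mulVec (v ∘ Sum.inr) ∧
          v ∘ Sum.inl = (Cm.map Polynomial.C).mulVec x +
            (Dm.map Polynomial.C).mulVec (v ∘ Sum.inr)} =
        {v | ∃ m : Fin k → F[X], v = G.mulVec m} ∧
      -- the degree of the code equals s:
      (Finset.univ.sup fun f : Fin k ↪ (Fin (n - k) ⊕ Fin k) =>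
        ((G.submatrix f id).det).natDegree) = s) ↔
    Matrix.rank (fun (i : Fin s) (p : Fin s × Fin k) => (A ^ (p.1 : ℕ) * B) i p.2) = s := by
  have key : ∀ G : Matrix (Fin (n - k) ⊕ Fin k) (Fin k) F[X],
      isoCode A B Cm Dm = {v | ∃ m, v = G *ᵥ m} →
      (Finset.univ.sup fun f : Fin k ↪ (Fin (n - k) ⊕ Fin k) =>
        ((G.submatrix f id).det).natDegree) =
      Matrix.rank (fun (i : Fin s) (p : Fin s × Fin k) => (A ^ (p.1 : ℕ) * B) i p.2) := by
    intro G hG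
    rw [← natDegree_det_of_range_eq_inputModule A B _ (range_inputRows_eq_inputModule hG) s
      (Fintype.card_fin s)]
    refine le_antisymm
      (Finset.sup_le fun f _ => natDegree_det_submatrix_le_of_isoCode_eq hG f) ?_
    have h := Finset.le_sup (s := Finset.univ) (f := fun f : Fin k ↪ (Fin (n - k) ⊕ Fin k) =>
      ((G.submatrix f id).det).natDegree)
      (Finset.mem_univ (⟨Sum.inr, Sum.inr_injective⟩ : Fin k ↪ (Fin (n - k) ⊕ Fin k)))
    exact h
  constructor
  · rintro ⟨G, -, hG, hs⟩
    rw [← key G hG, hs]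
  · intro hs
    obtain ⟨G, hlin, hG⟩ := exists_generator_isoCode A B Cm Dm
    exact ⟨G, hlin, hG, (key G hG).trans hs⟩
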